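/- There exists a constant C > 0 such that for every integer n ≥ 6 one has Δ_{5,5}(n) ≤ C · n^{−33/20}; equivalently, every n-element subset of [0,1]^5 contains 6 points spanning a 5-dimensional simplex of volume at most C · n^{−33/20}. -/

import Mathlib

open scoped RealInnerProductSpace

/-- The Gram matrix of a collection of `k` vectors in `ℝ^d`. -/
noncomputable def gram {d k : ℕ} (v : Fin k → EuclideanSpace ℝ (Fin d)) :
    Matrix (Fin k) (Fin k) ℝ :=
  Matrix.of fun i j => ⟪v i, v j⟫

/-- `vol v` is the `k`-dimensional volume of the parallelepiped spanned by
`v 1, …, v k`, i.e. the square root of the determinant of their Gram matrix.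
For `k = 0` it equals `1`. -/
noncomputable def vol {d k : ℕ} (v : Fin k → EuclideanSpace ℝ (Fin d)) : ℝ :=
  Real.sqrt (gram v).det

/-- The `k`-dimensional volume of the simplex with vertices `p 0, …, p k`. -/
noncomputable def simplexVol {d k : ℕ} (p : Fin (k + 1) → EuclideanSpace ℝ (Fin d)) : ℝ :=
  (Nat.factorial k : ℝ)⁻¹ * vol (fun i : Fin k => p i.succ - p 0)

/-- The minimum, over all `(k+1)`-element subsets of `X`, of the `k`-dimensional
volume of the simplex they span. -/
noncomputable def minSimplexVol (d k : ℕ) (X : Finset (EuclideanSpace ℝ (Fin d))) : ℝ :=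
  sInf { v : ℝ | ∃ p : Fin (k + 1) → EuclideanSpace ℝ (Fin d),
    Function.Injective p ∧ (∀ i, p i ∈ X) ∧ v = simplexVol p }

/-- `Delta k d n` is the supremum, over all `n`-element subsets `X` of the unit cube
`[0,1]^d`, of the minimum `k`-dimensional simplex volume among `(k+1)`-element
subsets of `X`. -/
noncomputable def Delta (k d n : ℕ) : ℝ :=
  sSup { v : ℝ | ∃ X : Finset (EuclideanSpace ℝ (Fin d)), X.card = n ∧
    (∀ x ∈ X, ∀ i, x i ∈ Set.Icc (0 : ℝ) 1) ∧ v = minSimplexVol d k X }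

section Pigeonhole

/-- Points in `[-1, 1]` that fall in the same cell of width `2 / K` are close. -/
theorem abs_sub_le_of_natFloor_eq {K : ℕ} (hK : 0 < K) {x y : ℝ} (hx : -1 ≤ x) (hy : -1 ≤ y)
    (h : ⌊(x + 1) / 2 * K⌋₊ = ⌊(y + 1) / 2 * K⌋₊) : |x - y| ≤ 2 / K := by
  have hK' : (0 : ℝ) < K := by exact_mod_cast hK
  have hx0 : 0 ≤ (x + 1) / 2 * K := mul_nonneg (by linarith) hK'.le
  have hy0 : 0 ≤ (y + 1) / 2 * K := mul_nonneg (by linarith) hK'.le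
  have h1 := Nat.floor_le hx0
  have h2 := Nat.lt_floor_add_one ((x + 1) / 2 * K)
  have h3 := Nat.floor_le hy0
  have h4 := Nat.lt_floor_add_one ((y + 1) / 2 * K)
  rw [h] at h1 h2
  rw [abs_le, ← neg_div, div_le_iff₀ hK', le_div_iff₀ hK']
  constructor <;> linarith

theorem natFloor_mem_range {K : ℕ} {x : ℝ} (hx : x ≤ 1) :
    ⌊(x + 1) / 2 * K⌋₊ ∈ Finset.range (K + 1) := by
  rw [Finset.mem_range, Nat.lt_succ_iff]
  apply Nat.floor_le_of_le
  have : (0 : ℝ) ≤ K := K.cast_nonneg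
  nlinarith

/-- Among more than `(K + 1) ^ m` points of a unit cube, two are at sup-distance at most `1 / K`. -/
theorem exists_ne_coord_close {ι : Type*} {m K : ℕ} (hK : 0 < K) (s : Finset ι)
    (v : ι → Fin m → ℝ) (hv : ∀ i ∈ s, ∀ k, v i k ∈ Set.Icc (0 : ℝ) 1)
    (hs : (K + 1) ^ m < s.card) :
    ∃ i ∈ s, ∃ j ∈ s, i ≠ j ∧ ∀ k, |v j k - v i k| ≤ 1 / K := by
  classical
  obtain ⟨i, hi, j, hj, hij, h⟩ := Finset.exists_ne_map_eq_of_card_lt_of_maps_to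
    (t := Fintype.piFinset fun _ : Fin m => Finset.range (K + 1))
    (f := fun i k => ⌊((2 * v i k - 1) + 1) / 2 * K⌋₊) (s := s) (by simpa using hs)
    (by
      intro i hi
      simp only [Finset.mem_coe, Fintype.mem_piFinset]
      intro k
      apply natFloor_mem_range
      linarith [(hv i hi k).2])
  refine ⟨i, hi, j, hj, hij, fun k => ?_⟩
  have := abs_sub_le_of_natFloor_eq hK (x := 2 * v j k - 1) (y := 2 * v i k - 1)
    (by linarith [(hv j hj k).1]) (by linarith [(hv i hi k).1]) (congrFun h k).symm
  have e : (2 * v j k - 1) - (2 * v i k - 1) = 2 * (v j k - v i k) := by ring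
  rw [e, abs_mul, abs_two, show (2 : ℝ) / K = 2 * (1 / K) by ring] at this
  linarith

/-- Among more than `(m + 1) (K + 1) ^ m` vectors of `ℝ^(m+1)`, two are nearly parallel. -/
theorem exists_ne_near_parallel {ι : Type*} {m K : ℕ} (hK : 0 < K) (s : Finset ι)
    (v : ι → Fin (m + 1) → ℝ) {R : ℝ} (hv : ∀ i ∈ s, ∀ k, |v i k| ≤ R)
    (hs : (m + 1) * (K + 1) ^ m < s.card) :
    ∃ i ∈ s, ∃ j ∈ s, i ≠ j ∧ ∃ t : ℝ, ∀ k, |v j k - t * v i k| ≤ 2 / K * R := by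
  classical
  have hmax : ∀ i, ∃ k, ∀ l, |v i l| ≤ |v i k| := fun i => Finite.exists_max _
  choose top htop using hmax
  have hratio : ∀ i l, |v i l / v i (top i)| ≤ 1 := fun i l => by
    rw [abs_div]
    exact div_le_one_of_le₀ (htop i l) (abs_nonneg _)
  obtain ⟨i, hi, j, hj, hij, h⟩ := Finset.exists_ne_map_eq_of_card_lt_of_maps_to
    (t := (Finset.univ : Finset (Fin (m + 1))) ×ˢ
      Fintype.piFinset fun _ : Fin m => Finset.range (K + 1))
    (f := fun i => (top i, fun l => ⌊(v i ((top i).succAbove l) / v i (top i) + 1) / 2 * K⌋₊))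
    (s := s) (by simpa using hs)
    (by
      intro i hi
      simp only [Finset.mem_coe, Finset.mem_product, Finset.mem_univ, true_and,
        Fintype.mem_piFinset]
      exact fun l => natFloor_mem_range (abs_le.1 (hratio _ _)).2)
  have hR : 0 ≤ R := (abs_nonneg _).trans (hv i hi 0)
  simp only [Prod.mk.injEq] at h
  obtain ⟨ht, hc⟩ := h
  by_cases h0 : v i (top i) = 0
  · refine ⟨j, hj, i, hi, hij.symm, 0, fun k => ?_⟩
    have := htop i k
    rw [h0, abs_zero] at this
    rw [zero_mul, sub_zero]
    exact this.trans (by positivity)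
  refine ⟨i, hi, j, hj, hij, v j (top i) / v i (top i), fun k => ?_⟩
  obtain rfl | ⟨l, rfl⟩ := (top i).eq_self_or_eq_succAbove k
  · rw [div_mul_cancel₀ _ h0, sub_self, abs_zero]
    positivity
  · by_cases h1 : v j (top j) = 0
    · have := htop j ((top i).succAbove l)
      rw [h1, abs_zero] at this
      rw [ht, h1, zero_div, zero_mul, sub_zero, ← ht]
      exact this.trans (by positivity)
    · have hc' := congrFun hc l
      have := abs_sub_le_of_natFloor_eq hK (abs_le.1 (hratio j ((top j).succAbove l))).1
        (abs_le.1 (hratio i ((top i).succAbove l))).1 hc'.symm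
      rw [← ht] at this h1
      have e : v j ((top i).succAbove l) - v j (top i) / v i (top i) * v i ((top i).succAbove l)
          = (v j ((top i).succAbove l) / v j (top i) - v i ((top i).succAbove l) / v i (top i))
            * v j (top i) := by
        field_simp
      rw [e, abs_mul]
      exact mul_le_mul this (hv j hj _) (abs_nonneg _) (by positivity)

/-- If every subset with more than `L` elements contains a related pair, then a set with at least
`L + 2 j` elements contains `j` pairwise disjoint related pairs. -/
theorem exists_disjoint_pairs {α : Type*} [DecidableEq α] (r : α → α → Prop) (L : ℕ) (j : ℕ) :
    ∀ X : Finset α, (∀ Y ⊆ X, L < Y.card → ∃ p ∈ Y, ∃ q ∈ Y, p ≠ q ∧ r p q) →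
      L + 2 * j ≤ X.card →
      ∃ P : Finset (α × α), P.card = j ∧
        (∀ π ∈ P, π.1 ∈ X ∧ π.2 ∈ X ∧ π.1 ≠ π.2 ∧ r π.1 π.2) ∧
        ∀ π ∈ P, ∀ ρ ∈ P, π ≠ ρ → π.1 ≠ ρ.1 ∧ π.1 ≠ ρ.2 ∧ π.2 ≠ ρ.1 ∧ π.2 ≠ ρ.2 := by
  induction j with
  | zero => exact fun X _ _ => ⟨∅, by simp⟩
  | succ j ih =>
    intro X hX hcard
    obtain ⟨p, hp, q, hq, hpq, hr⟩ := hX X subset_rfl (by omega)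
    have hsub : {p, q} ⊆ X := by
      intro z hz
      simp only [Finset.mem_insert, Finset.mem_singleton] at hz
      rcases hz with rfl | rfl <;> assumption
    obtain ⟨P, hPc, hP, hPd⟩ := ih (X \ {p, q})
      (fun Y hY => hX Y (hY.trans Finset.sdiff_subset))
      (by rw [Finset.card_sdiff_of_subset hsub, Finset.card_pair hpq]; omega)
    have hne : ∀ π ∈ P, π.1 ≠ p ∧ π.1 ≠ q ∧ π.2 ≠ p ∧ π.2 ≠ q := by
      intro π hπ
      have h := hP π hπ
      simp only [Finset.mem_sdiff, Finset.mem_insert, Finset.mem_singleton, not_or] at h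
      tauto
    refine ⟨insert (p, q) P, ?_, ?_, ?_⟩
    · rw [Finset.card_insert_of_notMem, hPc]
      exact fun h => (hne _ h).1 rfl
    · intro π hπ
      rcases Finset.mem_insert.1 hπ with rfl | hπ
      · exact ⟨hp, hq, hpq, hr⟩
      · have h := hP π hπ
        exact ⟨(Finset.mem_sdiff.1 h.1).1, (Finset.mem_sdiff.1 h.2.1).1, h.2.2⟩
    · intro π hπ ρ hρ hne'
      rcases Finset.mem_insert.1 hπ with rfl | hπ <;> rcases Finset.mem_insert.1 hρ with rfl | hρ
      · exact absurd rfl hne'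
      · have h := hne ρ hρ
        exact ⟨h.1.symm, h.2.2.1.symm, h.2.1.symm, h.2.2.2.symm⟩
      · exact hne π hπ
      · exact hPd π hπ ρ hρ hne'

end Pigeonhole

section Volume

theorem norm_le_three_mul {v : EuclideanSpace ℝ (Fin 5)} {s : ℝ} (hv : ∀ k, |v k| ≤ s) :
    ‖v‖ ≤ 3 * s := by
  have hs : 0 ≤ s := (abs_nonneg _).trans (hv 0)
  apply le_of_sq_le_sq _ (by positivity)
  rw [EuclideanSpace.real_norm_sq_eq]
  calc ∑ k, v k ^ 2 ≤ ∑ _k : Fin 5, s ^ 2 :=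
        Finset.sum_le_sum fun k _ => sq_le_sq' (abs_le.1 (hv k)).1 (abs_le.1 (hv k)).2
    _ ≤ (3 * s) ^ 2 := by simp; nlinarith [sq_nonneg s]

theorem norm_sub_le_three {x y : EuclideanSpace ℝ (Fin 5)}
    (hx : ∀ k, x k ∈ Set.Icc (0 : ℝ) 1) (hy : ∀ k, y k ∈ Set.Icc (0 : ℝ) 1) : ‖x - y‖ ≤ 3 := by
  have := norm_le_three_mul (v := x - y) (s := 1) fun k => by
    have h1 := hx k
    have h2 := hy k
    rw [PiLp.sub_apply, abs_le]
    constructor <;> linarith [h1.1, h1.2, h2.1, h2.2]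
  linarith

/-- The volume is the absolute value of the determinant in any orthonormal basis. -/
theorem vol_eq_abs_det {d : ℕ} (b : OrthonormalBasis (Fin d) ℝ (EuclideanSpace ℝ (Fin d)))
    (v : Fin d → EuclideanSpace ℝ (Fin d)) :
    vol v = |(Matrix.of fun i j => ⟪b j, v i⟫ : Matrix (Fin d) (Fin d) ℝ).det| := by
  set N : Matrix (Fin d) (Fin d) ℝ := Matrix.of fun i j => ⟪b j, v i⟫
  have h : gram v = N * N.transpose := by
    ext i j
    simp only [gram, N, Matrix.mul_apply, Matrix.transpose_apply, Matrix.of_apply]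
    rw [← b.sum_inner_mul_inner (v i) (v j)]
    exact Finset.sum_congr rfl fun k _ => by rw [real_inner_comm]
  rw [vol, h, Matrix.det_mul, Matrix.det_transpose, Real.sqrt_mul_self_eq_abs]

theorem det_fin_five_of_lower {N : Matrix (Fin 5) (Fin 5) ℝ}
    (h : ∀ i j : Fin 5, i < 3 → i < j → N i j = 0) :
    N.det = N 0 0 * (N 1 1 * (N 2 2 * (N 3 3 * N 4 4 - N 3 4 * N 4 3))) := by
  rw [Matrix.det_succ_row_zero, Finset.sum_eq_single 0]
  rotate_left
  · intro j _ hj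
    rw [h 0 j (by decide) (Fin.pos_of_ne_zero hj)]
    simp
  · simp
  rw [Matrix.det_succ_row_zero, Finset.sum_eq_single 0]
  rotate_left
  · intro j _ hj
    rw [Matrix.submatrix_apply, h _ _ (by decide) (by revert j; decide)]
    simp
  · simp
  rw [Matrix.det_succ_row_zero, Finset.sum_eq_single 0]
  rotate_left
  · intro j _ hj
    rw [Matrix.submatrix_apply, Matrix.submatrix_apply, h _ _ (by decide) (by revert j; decide)]
    simp
  · simp
  rw [Matrix.det_fin_two]
  simp

/-- Once `a`, `b`, `c` are fixed, the volume is controlled by the area of the projections of the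
last two vectors to a plane orthogonal to `a`, `b`, `c`. -/
theorem exists_vol_le (a b c : EuclideanSpace ℝ (Fin 5)) :
    ∃ f g : EuclideanSpace ℝ (Fin 5), ‖f‖ = 1 ∧ ‖g‖ = 1 ∧
      ∀ (t : ℝ) (v : Fin 5 → EuclideanSpace ℝ (Fin 5)), v 0 = a → v 1 = c → v 2 = b + c →
        vol v ≤ ‖a‖ * (‖c‖ * (‖b - t • a‖ *
          |⟪f, v 3⟫ * ⟪g, v 4⟫ - ⟪g, v 3⟫ * ⟪f, v 4⟫|)) := by
  set w : Fin 5 → EuclideanSpace ℝ (Fin 5) := ![a, c, b + c, 0, 0]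
  set e := InnerProductSpace.gramSchmidtOrthonormalBasis (𝕜 := ℝ) (by simp) w
  have htri : ∀ i j : Fin 5, i < j → ⟪e j, w i⟫ = 0 := fun i j hij =>
    InnerProductSpace.gramSchmidtOrthonormalBasis_inv_triangular _ _ hij
  refine ⟨e 3, e 4, e.norm_eq_one 3, e.norm_eq_one 4, fun t v h0 h1 h2 => ?_⟩
  have hvw : ∀ i : Fin 5, i < 3 → v i = w i := by
    intro i hi
    fin_cases i
    · exact h0
    · exact h1
    · exact h2
    · exact absurd hi (by decide)
    · exact absurd hi (by decide)
  have hin : ∀ (i : Fin 5) (x : EuclideanSpace ℝ (Fin 5)), |⟪e i, x⟫| ≤ ‖x‖ := fun i x => by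
    simpa [e.norm_eq_one i] using abs_real_inner_le_norm (e i) x
  rw [vol_eq_abs_det e, det_fin_five_of_lower fun i j hi hij => by
    rw [Matrix.of_apply, hvw i hi]; exact htri i j hij]
  simp only [Matrix.of_apply, abs_mul]
  have ha : ⟪e 2, a⟫ = 0 := htri 0 2 (by decide)
  have hc : ⟪e 2, c⟫ = 0 := htri 1 2 (by decide)
  have hb : ⟪e 2, v 2⟫ = ⟪e 2, b - t • a⟫ := by
    rw [h2, inner_add_right, inner_sub_right, inner_smul_right, ha, hc]
    ring
  rw [hb, h0, h1]
  gcongr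
  all_goals exact hin _ _

theorem abs_area_le {x₁ x₂ y₁ y₂ R ε t : ℝ} (hx₁ : |x₁| ≤ R) (hx₂ : |x₂| ≤ R)
    (h₁ : |y₁ - t * x₁| ≤ ε) (h₂ : |y₂ - t * x₂| ≤ ε) :
    |x₁ * y₂ - x₂ * y₁| ≤ 2 * (R * ε) := by
  have e : x₁ * y₂ - x₂ * y₁ = x₁ * (y₂ - t * x₂) - x₂ * (y₁ - t * x₁) := by ring
  have hR : 0 ≤ R := (abs_nonneg _).trans hx₁
  rw [e]
  calc _ ≤ |x₁ * (y₂ - t * x₂)| + |x₂ * (y₁ - t * x₁)| := abs_sub _ _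
    _ ≤ R * ε + R * ε := by
      rw [abs_mul, abs_mul]
      gcongr
    _ = _ := by ring

theorem simplexVol_nonneg {d k : ℕ} (p : Fin (k + 1) → EuclideanSpace ℝ (Fin d)) :
    0 ≤ simplexVol p := by
  unfold simplexVol vol
  positivity

theorem simplexVol_le_vol {d k : ℕ} (p : Fin (k + 1) → EuclideanSpace ℝ (Fin d)) :
    simplexVol p ≤ vol (fun i : Fin k => p i.succ - p 0) := by
  unfold simplexVol
  refine mul_le_of_le_one_left (Real.sqrt_nonneg _) (inv_le_one_of_one_le₀ ?_)
  exact_mod_cast k.factorial_pos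

theorem simplexVol_le_const {p : Fin 6 → EuclideanSpace ℝ (Fin 5)}
    (hp : ∀ i k, p i k ∈ Set.Icc (0 : ℝ) 1) : simplexVol p ≤ 486 := by
  obtain ⟨f, g, hf, hg, h⟩ := exists_vol_le (p 1 - p 0) (p 3 - p 2) (p 2 - p 0)
  have hn : ∀ i j, ‖p i - p j‖ ≤ 3 := fun i j => norm_sub_le_three (hp i) (hp j)
  have hfx : ∀ i, |⟪f, p i - p 0⟫| ≤ 3 := fun i =>
    (abs_real_inner_le_norm _ _).trans (by rw [hf, one_mul]; exact hn i 0)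
  have hgx : ∀ i, |⟪g, p i - p 0⟫| ≤ 3 := fun i =>
    (abs_real_inner_le_norm _ _).trans (by rw [hg, one_mul]; exact hn i 0)
  have harea := abs_area_le (hfx 4) (hgx 4) (t := 0) (ε := 3) (y₁ := ⟪f, p 5 - p 0⟫)
    (y₂ := ⟪g, p 5 - p 0⟫) (by simpa using hfx 5) (by simpa using hgx 5)
  calc simplexVol p ≤ _ := simplexVol_le_vol p
    _ ≤ _ := h 0 (fun i => p i.succ - p 0) rfl rfl (by
      change p 3 - p 0 = _
      abel)
    _ ≤ 3 * (3 * (3 * (2 * (3 * 3)))) := by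
      rw [zero_smul, sub_zero]
      gcongr
      · exact hn _ _
      · exact hn _ _
      · exact hn _ _
      · exact harea
    _ = 486 := by norm_num

end Volume

section Main

/-- Combinatorial form of the bound, with independent cell sizes for the three pigeonhole steps. -/
theorem exists_simplexVol_le {X : Finset (EuclideanSpace ℝ (Fin 5))} {K₁ K₂ K₃ j : ℕ}
    (hX : ∀ x ∈ X, ∀ k, x k ∈ Set.Icc (0 : ℝ) 1)
    (hK₁ : 0 < K₁) (hK₂ : 0 < K₂) (hK₃ : 0 < K₃)
    (h₁ : (K₁ + 1) ^ 5 + 2 * j ≤ X.card) (h₂ : 5 * (K₂ + 1) ^ 4 < j)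
    (h₃ : 2 * (K₃ + 1) + 4 < X.card) :
    ∃ p : Fin 6 → EuclideanSpace ℝ (Fin 5), Function.Injective p ∧ (∀ i, p i ∈ X) ∧
      simplexVol p ≤ 1944 * ((1 / K₁) ^ 2 * (1 / K₂) * (1 / K₃)) := by
  classical
  obtain ⟨P, hPc, hP, hPd⟩ := exists_disjoint_pairs
    (fun p q : EuclideanSpace ℝ (Fin 5) => ∀ k, |q k - p k| ≤ 1 / K₁) ((K₁ + 1) ^ 5) j X
    (fun Y hY hc => exists_ne_coord_close hK₁ Y (fun x k => x k)
      (fun x hx => hX x (hY hx)) hc) h₁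
  obtain ⟨π, hπ, ρ, hρ, hne, t, ht⟩ := exists_ne_near_parallel hK₂ P
    (fun π k => π.2 k - π.1 k) (R := 1 / K₁) (fun π hπ => (hP π hπ).2.2.2)
    (by rw [hPc]; exact h₂)
  obtain ⟨p₀, p₁⟩ := π
  obtain ⟨p₂, p₃⟩ := ρ
  obtain ⟨h0, h1, h01, hr⟩ := hP _ hπ
  obtain ⟨h2, h3, h23, -⟩ := hP _ hρ
  obtain ⟨h02, h03, h12, h13⟩ := hPd _ hπ _ hρ hne
  dsimp only at ht h0 h1 h01 hr h2 h3 h23 h02 h03 h12 h13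
  obtain ⟨f, g, hf, hg, h⟩ := exists_vol_le (p₁ - p₀) (p₃ - p₂) (p₂ - p₀)
  have hfx : ∀ x ∈ X, |⟪f, x - p₀⟫| ≤ 3 := fun x hx =>
    (abs_real_inner_le_norm _ _).trans
      (by rw [hf, one_mul]; exact norm_sub_le_three (hX x hx) (hX _ h0))
  have hgx : ∀ x ∈ X, |⟪g, x - p₀⟫| ≤ 3 := fun x hx =>
    (abs_real_inner_le_norm _ _).trans
      (by rw [hg, one_mul]; exact norm_sub_le_three (hX x hx) (hX _ h0))
  have hcard : 2 * (K₃ + 1) < (X \ {p₀, p₁, p₂, p₃}).card := by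
    have := Finset.le_card_sdiff {p₀, p₁, p₂, p₃} X
    have := Finset.card_le_four (a := p₀) (b := p₁) (c := p₂) (d := p₃)
    omega
  obtain ⟨x, hx, y, hy, hxy, s, hs⟩ := exists_ne_near_parallel (m := 1) hK₃
    (X \ {p₀, p₁, p₂, p₃}) (fun x => ![⟪f, x - p₀⟫, ⟪g, x - p₀⟫]) (R := 3)
    (by
      intro x hx k
      have hx := (Finset.mem_sdiff.1 hx).1
      fin_cases k
      · exact hfx x hx
      · exact hgx x hx)
    (by simpa using hcard)
  simp only [Finset.mem_sdiff, Finset.mem_insert, Finset.mem_singleton, not_or] at hx hy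
  obtain ⟨hx, hx0, hx1, hx2, hx3⟩ := hx
  obtain ⟨hy, hy0, hy1, hy2, hy3⟩ := hy
  have harea := abs_area_le (hfx x hx) (hgx x hx) (hs 0) (hs 1)
  refine ⟨![p₀, p₁, p₂, p₃, x, y], ?_, ?_, ?_⟩
  · simp only [Matrix.vecCons, Fin.cons_injective_iff, Set.mem_range, Fin.exists_fin_succ,
      Fin.cons_zero, Fin.cons_succ, not_or, IsEmpty.exists_iff, not_false_eq_true, and_true]
    exact ⟨⟨h01.symm, h02.symm, h03.symm, hx0, hy0⟩, ⟨h12.symm, h13.symm, hx1, hy1⟩,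
      ⟨h23.symm, hx2, hy2⟩, ⟨hx3, hy3⟩, hxy.symm, trivial,
      Function.injective_of_subsingleton _⟩
  · intro i
    fin_cases i <;> assumption
  · have hc : ‖p₂ - p₀‖ ≤ 3 := norm_sub_le_three (hX _ h2) (hX _ h0)
    have ha : ‖p₁ - p₀‖ ≤ 3 * (1 / K₁) := norm_le_three_mul fun k => hr k
    have hb : ‖(p₃ - p₂) - t • (p₁ - p₀)‖ ≤ 3 * (2 / K₂ * (1 / K₁)) :=
      norm_le_three_mul fun k => ht k
    refine (simplexVol_le_vol _).trans ((h t _ rfl rfl (by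
      change p₃ - p₀ = _
      abel)).trans ?_)
    calc _ ≤ 3 * (1 / (K₁ : ℝ)) * (3 * (3 * (2 / K₂ * (1 / K₁)) * (2 * (3 * (2 / K₃ * 3))))) := by
          gcongr
          exact harea
      _ = _ := by ring

theorem exists_nat_near {y : ℝ} (hy : 4 ≤ y) :
    ∃ K : ℕ, 0 < K ∧ (K + 1 : ℝ) ≤ y ∧ 1 / (K : ℝ) ≤ 2 * y⁻¹ := by
  have h1 := Nat.floor_le (show 0 ≤ y by linarith)
  have h2 := Nat.lt_floor_add_one y
  have h4 : 4 ≤ ⌊y⌋₊ := Nat.le_floor (by exact_mod_cast hy)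
  obtain ⟨K, hK⟩ : ∃ K, ⌊y⌋₊ = K + 1 := ⟨⌊y⌋₊ - 1, by omega⟩
  rw [hK] at h1 h2 h4
  push_cast at h1 h2
  refine ⟨K, by omega, h1, ?_⟩
  rw [show 2 * y⁻¹ = 1 / (y / 2) by field_simp]
  exact one_div_le_one_div_of_le (by linarith) (by linarith)

theorem rpow_one_div_pow {x : ℝ} (hx : 0 ≤ x) {k : ℕ} (hk : k ≠ 0) :
    (x ^ (1 / k : ℝ)) ^ k = x := by
  rw [one_div, Real.rpow_inv_natCast_pow hx hk]

theorem inv_div_rpow_le {x c a : ℝ} (hx : 0 ≤ x) (hc : 1 ≤ c) (ha : a ≤ 1) :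
    ((x / c) ^ a)⁻¹ ≤ c * x ^ (-a) := by
  rw [Real.div_rpow hx (by linarith), inv_div, div_eq_mul_inv, ← Real.rpow_neg hx]
  gcongr
  simpa using Real.rpow_le_rpow_of_exponent_le hc ha

theorem exists_simplexVol_le_rpow {X : Finset (EuclideanSpace ℝ (Fin 5))}
    (hX : ∀ x ∈ X, ∀ k, x k ∈ Set.Icc (0 : ℝ) 1) (hc : 12000 ≤ X.card) :
    ∃ p : Fin 6 → EuclideanSpace ℝ (Fin 5), Function.Injective p ∧ (∀ i, p i ∈ X) ∧
      simplexVol p ≤ 4 * 10 ^ 7 * (X.card : ℝ) ^ (-(33 / 20) : ℝ) := by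
  set n := X.card with hn
  have hn' : (12000 : ℝ) ≤ n := by exact_mod_cast hc
  have hn0 : (0 : ℝ) < n := by linarith
  set y₁ : ℝ := ((n : ℝ) / 2) ^ (1 / (5 : ℕ) : ℝ) with hy₁
  set y₂ : ℝ := ((n : ℝ) / 40) ^ (1 / (4 : ℕ) : ℝ) with hy₂
  have e₁ : y₁ ^ 5 = (n : ℝ) / 2 := rpow_one_div_pow (by positivity) (by norm_num)
  have e₂ : y₂ ^ 4 = (n : ℝ) / 40 := rpow_one_div_pow (by positivity) (by norm_num)
  have p₁ : 0 ≤ y₁ := by positivity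
  have p₂ : 0 ≤ y₂ := by positivity
  obtain ⟨K₁, hK₁, b₁, c₁⟩ := exists_nat_near (y := y₁)
    (le_of_pow_le_pow_left₀ (n := 5) (by norm_num) p₁ (by rw [e₁]; linarith))
  obtain ⟨K₂, hK₂, b₂, c₂⟩ := exists_nat_near (y := y₂)
    (le_of_pow_le_pow_left₀ (n := 4) (by norm_num) p₂ (by rw [e₂]; linarith))
  obtain ⟨K₃, hK₃, b₃, c₃⟩ := exists_nat_near (y := (n : ℝ) / 8) (by linarith)
  have d₁ : ((K₁ + 1 : ℕ) : ℝ) ^ 5 ≤ n / 2 := by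
    rw [← e₁]; push_cast; gcongr
  have d₂ : ((K₂ + 1 : ℕ) : ℝ) ^ 4 ≤ n / 40 := by
    rw [← e₂]; push_cast; gcongr
  have d₁' : 2 * (K₁ + 1) ^ 5 ≤ n := by
    have : (2 : ℝ) * ((K₁ + 1 : ℕ) : ℝ) ^ 5 ≤ n := by linarith
    exact_mod_cast this
  have d₂' : 40 * (K₂ + 1) ^ 4 ≤ n := by
    have : (40 : ℝ) * ((K₂ + 1 : ℕ) : ℝ) ^ 4 ≤ n := by linarith
    exact_mod_cast this
  have d₃' : 8 * (K₃ + 1) ≤ n := by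
    have : (8 : ℝ) * (K₃ + 1) ≤ n := by linarith
    exact_mod_cast this
  obtain ⟨p, hp, hpX, hv⟩ := exists_simplexVol_le (j := n / 4) hX hK₁ hK₂ hK₃
    (by omega) (by omega) (by omega)
  refine ⟨p, hp, hpX, hv.trans ?_⟩
  have f₁ := inv_div_rpow_le hn0.le (c := 2) (a := 1 / (5 : ℕ)) (by norm_num) (by norm_num)
  have f₂ := inv_div_rpow_le hn0.le (c := 40) (a := 1 / (4 : ℕ)) (by norm_num) (by norm_num)
  have f₃ : ((n : ℝ) / 8)⁻¹ = 8 * (n : ℝ) ^ (-1 : ℝ) := by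
    rw [Real.rpow_neg_one, inv_div, div_eq_mul_inv]
  have hexp : ((n : ℝ) ^ (-(1 / (5 : ℕ)) : ℝ)) ^ 2 * (n : ℝ) ^ (-(1 / (4 : ℕ)) : ℝ) *
      (n : ℝ) ^ (-1 : ℝ) = (n : ℝ) ^ (-(33 / 20) : ℝ) := by
    rw [← Real.rpow_mul_natCast hn0.le, ← Real.rpow_add hn0, ← Real.rpow_add hn0]
    norm_num
  calc 1944 * ((1 / (K₁ : ℝ)) ^ 2 * (1 / K₂) * (1 / K₃))
      ≤ 1944 * ((2 * (2 * (n : ℝ) ^ (-(1 / (5 : ℕ)) : ℝ))) ^ 2 *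
          (2 * (40 * (n : ℝ) ^ (-(1 / (4 : ℕ)) : ℝ))) * (2 * (8 * (n : ℝ) ^ (-1 : ℝ)))) := by
        gcongr
        · exact c₁.trans (by gcongr)
        · exact c₂.trans (by gcongr)
        · rw [← f₃]; exact c₃
    _ = 39813120 * (n : ℝ) ^ (-(33 / 20) : ℝ) := by rw [← hexp]; ring
    _ ≤ _ := by gcongr; norm_num

end Main

/-- **Corollary 2 (case d = 5).** There is a constant `C > 0` such that for every
`n ≥ 6` one has `Δ_{5,5}(n) ≤ C · n^(-(33/20))`: every `n`-element subset of `[0,1]^5`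
contains 6 points spanning a simplex of 5-dimensional volume at most `C · n^(-(33/20))`. -/
theorem delta_five_five :
    ∃ C : ℝ, 0 < C ∧ ∀ n : ℕ, 6 ≤ n →
      Delta 5 5 n ≤ C * (n : ℝ) ^ ((-(33/20) : ℝ)) := by
  refine ⟨4 * 10 ^ 7 + 486 * (12000 : ℝ) ^ (33 / 20 : ℝ), by positivity, fun n hn => ?_⟩
  have hn0 : (0 : ℝ) < n := by exact_mod_cast (by omega : 0 < n)
  refine Real.sSup_le ?_ (by positivity)
  rintro _ ⟨X, rfl, hX, rfl⟩
  obtain ⟨p, hp, hpX, hv⟩ : ∃ p : Fin 6 → EuclideanSpace ℝ (Fin 5), Function.Injective p ∧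
      (∀ i, p i ∈ X) ∧ simplexVol p ≤ (4 * 10 ^ 7 + 486 * (12000 : ℝ) ^ (33 / 20 : ℝ)) *
        (X.card : ℝ) ^ (-(33 / 20) : ℝ) := by
    rcases le_total 12000 X.card with hc | hc
    · obtain ⟨p, hp, hpX, hv⟩ := exists_simplexVol_le_rpow hX hc
      refine ⟨p, hp, hpX, hv.trans ?_⟩
      gcongr
      exact le_add_of_nonneg_right (by positivity)
    · obtain ⟨S, hS, hSc⟩ := Finset.exists_subset_card_eq hn
      let e := S.equivFinOfCardEq hSc
      refine ⟨fun i => (e.symm i : EuclideanSpace ℝ (Fin 5)),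
        Subtype.val_injective.comp e.symm.injective, fun i => hS (e.symm i).2,
        (simplexVol_le_const fun i => hX _ (hS (e.symm i).2)).trans ?_⟩
      have hle : (X.card : ℝ) ^ (33 / 20 : ℝ) ≤ (12000 : ℝ) ^ (33 / 20 : ℝ) :=
        Real.rpow_le_rpow hn0.le (by exact_mod_cast hc) (by norm_num)
      rw [Real.rpow_neg hn0.le, ← div_eq_mul_inv, le_div_iff₀ (by positivity)]
      linarith
  refine le_trans (csInf_le ⟨0, ?_⟩ ⟨p, hp, hpX, rfl⟩) hv
  rintro _ ⟨q, -, -, rfl⟩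
  exact simplexVol_nonneg q
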